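/- (Genus-two, one-pole case of Theorem 1.1.) For every integer k ≥ 1, the number of (k+3)-tuples (τ1, …, τ_{k+3}) of transpositions in S_k whose product τ1⋯τ_{k+3} is a single k-cycle equals (k − 1)(5k − 7) · (k + 3)! · k^{k+2} / 5760. Equivalently, the genus-two one-pole Hurwitz number is h_{2;k} = (k − 1)(5k − 7)(k + 3)! k^{k+2} / (5760 · k!). -/

import Mathlib

open Equiv

/-- The cycle type of a permutation of `Fin k` where fixed points are counted as
cycles of length 1 (Mathlib's `cycleType` records only nontrivial cycles).
A permutation `σ` of `Fin k` is a `k`-cycle iff `fullCycleType σ = {k}`. -/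
def fullCycleType {k : ℕ} (σ : Perm (Fin k)) : Multiset ℕ :=
  σ.cycleType + Multiset.replicate (k - σ.support.card) 1

/-- `N_{g,k}`: the number of `(k + 2g - 1)`-tuples of transpositions in `S_k` whose
product is a single `k`-cycle. -/
noncomputable def oneHoleCount (g k : ℕ) : ℕ :=
  Nat.card {τ : Fin (k + 2 * g - 1) → Perm (Fin k) //
    (∀ i, (τ i).IsSwap) ∧ fullCycleType (List.ofFn τ).prod = ({k} : Multiset ℕ)}

/-- The one-pole Hurwitz number `h_{g;k} = N_{g,k} / k!`. -/
noncomputable def oneHoleHurwitzNumber (g k : ℕ) : ℚ :=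
  (oneHoleCount g k : ℚ) / (k.factorial : ℚ)

section HookCharacters

open Polynomial Matrix

section CentralFactorial

/-- The Euler-type operator sending a rational polynomial `p` to `x p - X dp/dX`. -/
noncomputable def eulerShift (x : ℚ) : ℚ[X] →ₗ[ℚ] ℚ[X] :=
  x • LinearMap.id - LinearMap.mulLeft ℚ X ∘ₗ Polynomial.derivative

lemma eulerShift_apply (x : ℚ) (p : ℚ[X]) :
    eulerShift x p = C x * p - X * derivative p := by
  simp [eulerShift, smul_eq_C_mul]

lemma eulerShift_X_mul (x : ℚ) (p : ℚ[X]) :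
    eulerShift x (X * p) = X * eulerShift (x - 1) p := by
  simp only [eulerShift_apply, derivative_mul, derivative_X, C_sub, C_1]
  ring

lemma eulerShift_pow_X_mul (x : ℚ) (m : ℕ) (p : ℚ[X]) :
    (eulerShift x ^ m) (X * p) = X * (eulerShift (x - 1) ^ m) p := by
  induction m generalizing p with
  | zero => simp
  | succ m ih => rw [pow_succ, pow_succ, Module.End.mul_apply, Module.End.mul_apply,
      eulerShift_X_mul, ih]

/-- The value at `1` of the iterated Euler-type operator on `(1 - X) ^ d`; this is the alternating
sum `∑ r, (-1) ^ r * d.choose r * (x - r) ^ m`. -/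
noncomputable def alternatingPowerSum (m d : ℕ) (x : ℚ) : ℚ :=
  ((eulerShift x ^ m) ((1 - X) ^ d)).eval 1

lemma alternatingPowerSum_zero_right (m : ℕ) (x : ℚ) :
    alternatingPowerSum m 0 x = x ^ m := by
  have h : (eulerShift x ^ m) 1 = C (x ^ m) := by
    induction m with
    | zero => simp
    | succ m ih =>
      rw [pow_succ', Module.End.mul_apply, ih, eulerShift_apply]
      simp [pow_succ']
  simp [alternatingPowerSum, h]

lemma alternatingPowerSum_zero_succ (d : ℕ) (x : ℚ) :
    alternatingPowerSum 0 (d + 1) x = 0 := by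
  simp [alternatingPowerSum]

lemma alternatingPowerSum_succ_succ (m d : ℕ) (x : ℚ) :
    alternatingPowerSum (m + 1) (d + 1) x =
      x * alternatingPowerSum m (d + 1) x + (d + 1) * alternatingPowerSum m d (x - 1) := by
  have h : eulerShift x ((1 - X) ^ (d + 1)) =
      x • (1 - X) ^ (d + 1) + ((d : ℚ) + 1) • (X * (1 - X) ^ d) := by
    rw [eulerShift_apply, derivative_pow]
    simp [smul_eq_C_mul]
    ring
  rw [alternatingPowerSum, pow_succ, Module.End.mul_apply, h, map_add, map_smul, map_smul,
    eulerShift_pow_X_mul]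
  simp [alternatingPowerSum]

lemma alternatingPowerSum_of_lt {m d : ℕ} (h : m < d) (x : ℚ) :
    alternatingPowerSum m d x = 0 := by
  induction m generalizing d x with
  | zero =>
    obtain ⟨e, rfl⟩ := Nat.exists_eq_succ_of_ne_zero h.ne'
    exact alternatingPowerSum_zero_succ e x
  | succ m ih =>
    obtain ⟨e, rfl⟩ := Nat.exists_eq_succ_of_ne_zero (Nat.ne_of_gt (Nat.zero_lt_of_lt h))
    rw [Nat.succ_eq_add_one, alternatingPowerSum_succ_succ, ih (by omega), ih (by omega)]
    simp

lemma alternatingPowerSum_self (d : ℕ) (x : ℚ) :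
    alternatingPowerSum d d x = d.factorial := by
  induction d generalizing x with
  | zero => simp [alternatingPowerSum_zero_right]
  | succ d ih =>
    rw [alternatingPowerSum_succ_succ, ih, alternatingPowerSum_of_lt (by omega),
      Nat.factorial_succ]
    push_cast
    ring

lemma alternatingPowerSum_add_one (d : ℕ) (x : ℚ) :
    alternatingPowerSum (d + 1) d x = (d + 1).factorial * (x - d / 2) := by
  induction d generalizing x with
  | zero => simp [alternatingPowerSum_zero_right]
  | succ d ih =>
    rw [alternatingPowerSum_succ_succ, ih, alternatingPowerSum_self]
    simp only [Nat.factorial_succ]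
    push_cast
    ring

lemma alternatingPowerSum_add_two (d : ℕ) (x : ℚ) :
    alternatingPowerSum (d + 2) d x =
      (d + 2).factorial * ((x - d / 2) ^ 2 / 2 + d / 24) := by
  induction d generalizing x with
  | zero => simp [alternatingPowerSum_zero_right]; ring
  | succ d ih =>
    rw [show d + 1 + 2 = d + 2 + 1 from rfl, alternatingPowerSum_succ_succ, ih,
      show d + 2 = d + 1 + 1 from rfl, alternatingPowerSum_add_one]
    simp only [Nat.factorial_succ]
    push_cast
    ring

lemma alternatingPowerSum_add_three (d : ℕ) (x : ℚ) :
    alternatingPowerSum (d + 3) d x =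
      (d + 3).factorial * ((x - d / 2) ^ 3 / 6 + d / 24 * (x - d / 2)) := by
  induction d generalizing x with
  | zero => simp [alternatingPowerSum_zero_right, Nat.factorial]; ring
  | succ d ih =>
    rw [show d + 1 + 3 = d + 3 + 1 from rfl, alternatingPowerSum_succ_succ, ih,
      show d + 3 = d + 1 + 2 from rfl, alternatingPowerSum_add_two]
    simp only [Nat.factorial_succ]
    push_cast
    ring

lemma alternatingPowerSum_add_four (d : ℕ) (x : ℚ) :
    alternatingPowerSum (d + 4) d x =
      (d + 4).factorial * ((x - d / 2) ^ 4 / 24 + d / 48 * (x - d / 2) ^ 2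
        + d * (5 * d - 2) / 5760) := by
  induction d generalizing x with
  | zero => simp [alternatingPowerSum_zero_right, Nat.factorial]; ring
  | succ d ih =>
    rw [show d + 1 + 4 = d + 4 + 1 from rfl, alternatingPowerSum_succ_succ, ih,
      show d + 4 = d + 1 + 3 from rfl, alternatingPowerSum_add_three]
    simp only [Nat.factorial_succ]
    push_cast
    ring

end CentralFactorial

section Determinant

variable {n : Type*} [Fintype n] [DecidableEq n]

/-- The matrix determinant lemma for a matrix over a domain with nonzero determinant. -/
lemma det_add_vecMulVec_of_det_ne_zero {R : Type*} [CommRing R] [IsDomain R]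
    (A : Matrix n n R) (hA : A.det ≠ 0) (u v : n → R) :
    (A + vecMulVec u v).det = A.det + v ⬝ᵥ (A.adjugate *ᵥ u) := by
  let f := algebraMap R (FractionRing R)
  have hf : Function.Injective f := IsFractionRing.injective R (FractionRing R)
  have hdet : (A.map f).det = f A.det := (RingHom.map_det f A).symm
  have hne : f A.det ≠ 0 := by simpa using hf.ne hA
  have hu : IsUnit (A.map f).det := by rw [hdet]; exact hne.isUnit
  have hadj : (A.map f).adjugate = A.adjugate.map f := (RingHom.map_adjugate f A).symm
  apply hf
  have key := det_add_replicateCol_mul_replicateRow (ι := Unit) hu (f ∘ u) (f ∘ v)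
  rw [RingHom.map_det, map_add]
  have e1 : f.mapMatrix A + f.mapMatrix (vecMulVec u v) =
      A.map f + replicateCol Unit (f ∘ u) * replicateRow Unit (f ∘ v) := by
    ext i j
    simp [vecMulVec_apply, Matrix.mul_apply]
  rw [e1, key, Matrix.inv_def, hadj, hdet, det_unique (n := Unit)]
  have e2 : (replicateRow Unit (f ∘ v) * Ring.inverse (f A.det) • A.adjugate.map f *
      replicateCol Unit (f ∘ u)) default default
      = (f A.det)⁻¹ * f (v ⬝ᵥ (A.adjugate *ᵥ u)) := by
    rw [Ring.inverse_eq_inv', Matrix.mul_smul, Matrix.smul_mul, Matrix.smul_apply, smul_eq_mul,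
      Matrix.mul_assoc]
    congr 1
    simp [Matrix.mul_apply, dotProduct, mulVec, map_sum]
  rw [Matrix.add_apply, e2, mul_add, mul_inv_cancel_left₀ hne]
  simp

/-- Jacobi's formula for the derivative of the determinant of a polynomial matrix. -/
lemma derivative_det_eq_trace {R : Type*} [CommRing R] (A : Matrix n n R[X]) :
    derivative A.det = (A.adjugate * A.map derivative).trace := by
  have h : ∀ j, (A.adjugate * A.map derivative) j j =
      (A.updateCol j (fun i => derivative (A i j))).det := by
    intro j
    rw [← cramer_apply, cramer_eq_adjugate_mulVec]
    rfl
  simp only [trace, diag_apply, h, det_apply, map_sum]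
  rw [Finset.sum_comm]
  refine Finset.sum_congr rfl fun π _ => ?_
  rw [← Finset.smul_sum, Units.smul_def, derivative_smul, derivative_prod_finset, Units.smul_def]
  congr 1
  refine Finset.sum_congr rfl fun j _ => ?_
  rw [← Finset.mul_prod_erase _ _ (Finset.mem_univ j), mul_comm]
  simp only [updateCol_self]
  congr 1
  refine Finset.prod_congr rfl fun i hi => ?_
  rw [updateCol_ne (Finset.ne_of_mem_erase hi)]

end Determinant

section Swaps

variable {n : Type*} [Fintype n] [DecidableEq n]

lemma sum_sum_swap [Fintype {τ : Perm n // τ.IsSwap}] {A : Type*} [AddCommGroup A]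
    (g : Perm n → A) :
    ∑ i, ∑ j, g (swap i j) =
      2 • ∑ τ : {τ : Perm n // τ.IsSwap}, g τ + Fintype.card n • g 1 := by
  classical
  have hdiag : ∀ i, ∑ j, g (swap i j) = ∑ j, (if i ≠ j then g (swap i j) else 0) + g 1 := by
    intro i
    rw [← Finset.add_sum_erase _ _ (Finset.mem_univ i), swap_self,
      ← Finset.add_sum_erase _ (fun j => if i ≠ j then g (swap i j) else 0) (Finset.mem_univ i)]
    simp only [ne_eq, not_true_eq_false, if_false, zero_add]
    rw [add_comm]
    congr 1
    refine Finset.sum_congr rfl fun j hj => ?_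
    have : i ≠ j := by simpa [eq_comm] using hj
    simp [this]
  simp_rw [hdiag, Finset.sum_add_distrib]
  rw [Finset.sum_const, Finset.card_univ]
  congr 1
  rw [← Fintype.sum_prod_type' (f := fun i j => if i ≠ j then g (swap i j) else 0),
    ← Finset.sum_filter]
  rw [← Finset.sum_fiberwise_of_maps_to (t := Finset.univ.filter fun τ : Perm n => τ.IsSwap)
    (g := fun p : n × n => Equiv.swap p.1 p.2)]
  · rw [Finset.sum_subtype (p := fun τ : Perm n => τ.IsSwap)
      (Finset.univ.filter fun τ : Perm n => τ.IsSwap) (by simp), Finset.smul_sum]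
    refine Finset.sum_congr rfl fun ⟨τ, a, b, hab, hτ⟩ _ => ?_
    subst hτ
    have : (Finset.univ.filter fun p : n × n => p.1 ≠ p.2).filter
        (fun p : n × n => Equiv.swap p.1 p.2 = Equiv.swap a b) = {(a, b), (b, a)} := by
      ext ⟨i, j⟩
      simp only [Finset.mem_filter, Finset.mem_univ, true_and, Finset.mem_insert,
        Finset.mem_singleton, Prod.mk.injEq]
      constructor
      · rintro ⟨hij, h⟩
        have h1 : swap a b i = j := by rw [← h, swap_apply_left]
        rw [swap_apply_def] at h1
        split_ifs at h1 with h2 h3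
        · exact Or.inl ⟨h2, h1.symm⟩
        · exact Or.inr ⟨h3, h1.symm⟩
        · exact absurd h1 hij
      · rintro (⟨rfl, rfl⟩ | ⟨rfl, rfl⟩)
        · exact ⟨hab, rfl⟩
        · exact ⟨hab.symm, swap_comm _ _⟩
    rw [Finset.sum_congr this (g := fun _ => g (swap a b))]
    · rw [Finset.sum_const, Finset.card_pair (by simp [hab])]
    · intro p hp
      rw [← this] at hp
      rw [(Finset.mem_filter.mp hp).2]
  · rintro ⟨i, j⟩ hp
    simp only [Finset.mem_filter, Finset.mem_univ, true_and] at hp ⊢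
    exact ⟨i, j, hp, rfl⟩

end Swaps

section PermutationDeterminant

variable {n : Type*} [DecidableEq n]

/-- The matrix `1 - X • P` over `ℚ[X]`, where `P` is the permutation matrix of `σ`. -/
noncomputable def oneSubXPerm (σ : Perm n) : Matrix n n ℚ[X] :=
  1 - (X : ℚ[X]) • σ.permMatrix ℚ[X]

lemma oneSubXPerm_apply (σ : Perm n) (i j : n) :
    oneSubXPerm σ i j = (if i = j then 1 else 0) - (if σ i = j then X else 0) := by
  simp [oneSubXPerm, Matrix.one_apply, PEquiv.toMatrix_apply, Equiv.toPEquiv_apply, eq_comm]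

lemma permMatrix_swap (i j : n) :
    (Equiv.swap i j).permMatrix ℚ[X] =
      1 - vecMulVec (Pi.single i 1 - Pi.single j 1) (Pi.single i 1 - Pi.single j 1) := by
  ext1 a b
  simp only [PEquiv.toMatrix_apply, Equiv.toPEquiv_apply, Matrix.sub_apply, Matrix.one_apply,
    vecMulVec_apply, Pi.sub_apply, Pi.single_apply, swap_apply_def, Option.mem_def,
    Option.some.injEq]
  by_cases hai : a = i <;> by_cases haj : a = j <;> by_cases hbi : b = i <;>
    by_cases hbj : b = j <;> grind

variable [Fintype n]

lemma oneSubXPerm_mulVec_one (σ : Perm n) :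
    oneSubXPerm σ *ᵥ (fun _ => 1) = fun _ => 1 - X := by
  ext1 i
  simp [mulVec, dotProduct, oneSubXPerm_apply, Finset.sum_sub_distrib]

lemma eval_zero_det_oneSubXPerm (σ : Perm n) : (oneSubXPerm σ).det.eval 0 = 1 := by
  rw [← coe_evalRingHom, RingHom.map_det]
  convert Matrix.det_one (n := n) (R := ℚ)
  ext i j
  rw [RingHom.mapMatrix_apply, Matrix.map_apply, oneSubXPerm_apply, Matrix.one_apply]
  split_ifs <;> simp

lemma det_oneSubXPerm_ne_zero (σ : Perm n) : (oneSubXPerm σ).det ≠ 0 := by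
  intro h
  simpa [h] using eval_zero_det_oneSubXPerm σ

lemma det_oneSubXPerm_one :
    (oneSubXPerm (1 : Perm n)).det = (1 - X) ^ Fintype.card n := by
  have : oneSubXPerm (1 : Perm n) = (1 - X : ℚ[X]) • 1 := by
    simp [oneSubXPerm, sub_smul]
  rw [this, det_smul, det_one, mul_one]

lemma adjugate_mul_X_smul_permMatrix (σ : Perm n) :
    (oneSubXPerm σ).adjugate * ((X : ℚ[X]) • σ.permMatrix ℚ[X]) =
      (oneSubXPerm σ).adjugate - (oneSubXPerm σ).det • 1 := by
  have h : (X : ℚ[X]) • σ.permMatrix ℚ[X] = 1 - oneSubXPerm σ := by simp [oneSubXPerm]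
  rw [h, Matrix.mul_sub, Matrix.mul_one, adjugate_mul]

lemma X_mul_derivative_det_oneSubXPerm (σ : Perm n) :
    X * derivative (oneSubXPerm σ).det =
      (Fintype.card n : ℚ[X]) * (oneSubXPerm σ).det - (oneSubXPerm σ).adjugate.trace := by
  have h : (X : ℚ[X]) • (oneSubXPerm σ).map derivative = -((X : ℚ[X]) • σ.permMatrix ℚ[X]) := by
    ext1 i j
    simp only [Matrix.smul_apply, Matrix.map_apply, oneSubXPerm_apply, Matrix.neg_apply,
      PEquiv.toMatrix_apply, Equiv.toPEquiv_apply]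
    split_ifs <;> simp_all
  rw [derivative_det_eq_trace, ← smul_eq_mul, ← trace_smul, ← Matrix.mul_smul, h, Matrix.mul_neg,
    adjugate_mul_X_smul_permMatrix, trace_neg, trace_sub, trace_smul, trace_one, smul_eq_mul]
  ring

lemma one_sub_X_mul_sum_adjugate_oneSubXPerm (σ : Perm n) :
    (1 - X) * ∑ i, ∑ j, (oneSubXPerm σ).adjugate i j =
      (Fintype.card n : ℚ[X]) * (oneSubXPerm σ).det := by
  have h := congrArg ((oneSubXPerm σ).adjugate *ᵥ ·) (oneSubXPerm_mulVec_one σ)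
  simp only [mulVec_mulVec, adjugate_mul] at h
  have hi : ∀ i, (1 - X) * ∑ j, (oneSubXPerm σ).adjugate i j = (oneSubXPerm σ).det := by
    intro i
    have := congrFun h i
    simp only [mulVec, dotProduct, Matrix.smul_apply, Matrix.one_apply, smul_eq_mul, mul_ite,
      mul_one, mul_zero, Finset.sum_ite_eq, Finset.mem_univ, if_true] at this
    rw [this, Finset.mul_sum]
    exact Finset.sum_congr rfl fun j _ => mul_comm _ _
  rw [Finset.mul_sum, Finset.sum_congr rfl fun i _ => hi i]
  simp

lemma det_oneSubXPerm_swap_mul (σ : Perm n) (i j : n) :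
    (oneSubXPerm (Equiv.swap i j * σ)).det = (oneSubXPerm σ).det +
      (((oneSubXPerm σ).adjugate - (oneSubXPerm σ).det • 1) i i
      + ((oneSubXPerm σ).adjugate - (oneSubXPerm σ).det • 1) j j
      - ((oneSubXPerm σ).adjugate - (oneSubXPerm σ).det • 1) i j
      - ((oneSubXPerm σ).adjugate - (oneSubXPerm σ).det • 1) j i) := by
  set v : n → ℚ[X] := Pi.single i 1 - Pi.single j 1 with hv
  have h : oneSubXPerm (Equiv.swap i j * σ) =
      oneSubXPerm σ + vecMulVec (((X : ℚ[X]) • σ.permMatrix ℚ[X]) *ᵥ v) v := by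
    rw [oneSubXPerm, permMatrix_mul, permMatrix_swap, ← hv, Matrix.mul_sub, Matrix.mul_one,
      mul_vecMulVec, smul_sub, smul_mulVec, smul_vecMulVec, oneSubXPerm]
    abel
  rw [h, det_add_vecMulVec_of_det_ne_zero _ (det_oneSubXPerm_ne_zero σ), mulVec_mulVec,
    adjugate_mul_X_smul_permMatrix]
  generalize (oneSubXPerm σ).adjugate - (oneSubXPerm σ).det • 1 = B
  rw [hv, mulVec_sub, sub_dotProduct, dotProduct_sub, dotProduct_sub]
  simp only [mulVec_single_one, single_one_dotProduct, col_apply]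
  ring

lemma sum_det_oneSubXPerm_swap_mul [Fintype {τ : Perm n // τ.IsSwap}] (σ : Perm n) :
    (1 - X) * (2 * ∑ τ : {τ : Perm n // τ.IsSwap}, (oneSubXPerm (τ.1 * σ)).det) =
      (1 - X) * (((Fintype.card n : ℚ[X]) ^ 2 + (Fintype.card n : ℚ[X])) * (oneSubXPerm σ).det
        - 2 * (Fintype.card n : ℚ[X]) * (X * derivative (oneSubXPerm σ).det))
      - 2 * (Fintype.card n : ℚ[X]) * (oneSubXPerm σ).det := by
  have h := sum_sum_swap fun τ : Perm n => (oneSubXPerm (τ * σ)).det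
  simp only [det_oneSubXPerm_swap_mul, one_mul, nsmul_eq_mul, Nat.cast_ofNat] at h
  simp only [Matrix.sub_apply, Finset.sum_add_distrib, Finset.sum_sub_distrib, Matrix.smul_apply,
    Matrix.one_apply, smul_eq_mul, mul_ite, mul_one, mul_zero, if_true, Finset.sum_const,
    Finset.card_univ, nsmul_eq_mul, Finset.sum_ite_eq, Finset.sum_ite_eq', Finset.mem_univ] at h
  have hc : ∑ i, ∑ j, (oneSubXPerm σ).adjugate j i = ∑ i, ∑ j, (oneSubXPerm σ).adjugate i j :=
    Finset.sum_comm
  have ht : ∑ i, (oneSubXPerm σ).adjugate i i = (oneSubXPerm σ).adjugate.trace := rfl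
  rw [hc, ← Finset.mul_sum, ht] at h
  rw [X_mul_derivative_det_oneSubXPerm]
  linear_combination (X - 1) * h - 2 * one_sub_X_mul_sum_adjugate_oneSubXPerm σ

end PermutationDeterminant

section ReducedDeterminant

variable {n : Type*} [Fintype n] [DecidableEq n]

lemma dvd_det_of_mulVec_one_eq [Nonempty n] {R : Type*} [CommRing R] {A : Matrix n n R} {c : R}
    (h : A *ᵥ (fun _ => 1) = fun _ => c) : c ∣ A.det := by
  obtain ⟨i⟩ := ‹Nonempty n›
  have h' := congrFun (congrArg (A.adjugate *ᵥ ·) h) i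
  simp only [mulVec_mulVec, adjugate_mul] at h'
  refine ⟨∑ j, A.adjugate i j, ?_⟩
  simp only [mulVec, dotProduct, Matrix.smul_apply, Matrix.one_apply, smul_eq_mul, mul_ite,
    mul_one, mul_zero, Finset.sum_ite_eq, Finset.mem_univ, if_true] at h'
  rw [h', Finset.mul_sum]
  exact Finset.sum_congr rfl fun j _ => mul_comm _ _

lemma one_sub_X_ne_zero : (1 - X : ℚ[X]) ≠ 0 := by
  intro h
  simpa using congrArg (eval 0) h

/-- The quotient `det (1 - X • P) / (1 - X)`, where `P` is the permutation matrix of `σ`. -/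
noncomputable def reducedDet (σ : Perm n) : ℚ[X] :=
  (oneSubXPerm σ).det / (1 - X)

lemma one_sub_X_mul_reducedDet [Nonempty n] (σ : Perm n) :
    (1 - X) * reducedDet σ = (oneSubXPerm σ).det :=
  EuclideanDomain.mul_div_cancel' one_sub_X_ne_zero
    (dvd_det_of_mulVec_one_eq (oneSubXPerm_mulVec_one σ))

lemma reducedDet_one [Nonempty n] :
    reducedDet (1 : Perm n) = (1 - X) ^ (Fintype.card n - 1) := by
  apply mul_left_cancel₀ one_sub_X_ne_zero
  rw [one_sub_X_mul_reducedDet, det_oneSubXPerm_one, ← pow_succ',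
    Nat.sub_add_cancel Fintype.card_pos]

lemma sum_reducedDet_swap_mul [Nonempty n] [Fintype {τ : Perm n // τ.IsSwap}] (σ : Perm n) :
    ∑ τ : {τ : Perm n // τ.IsSwap}, reducedDet (τ.1 * σ) =
      (Fintype.card n : ℚ) • eulerShift (((Fintype.card n : ℚ) - 1) / 2) (reducedDet σ) := by
  have h := sum_det_oneSubXPerm_swap_mul σ
  simp only [← one_sub_X_mul_reducedDet, ← Finset.mul_sum] at h
  rw [derivative_mul] at h
  simp only [derivative_sub, derivative_one, derivative_X] at h
  have hC : (2 : ℚ[X]) * C (((Fintype.card n : ℚ) - 1) / 2) = (Fintype.card n : ℚ[X]) - 1 := by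
    rw [show (2 : ℚ[X]) = C 2 from rfl, ← C_mul, mul_div_cancel₀ _ (two_ne_zero), C_sub]
    simp
  have h2 : (1 - X : ℚ[X]) * (1 - X) * 2 ≠ 0 :=
    mul_ne_zero (mul_ne_zero one_sub_X_ne_zero one_sub_X_ne_zero) two_ne_zero
  apply mul_left_cancel₀ h2
  rw [smul_eq_C_mul, eulerShift_apply, map_natCast]
  linear_combination h -
    (1 - X) * (1 - X) * (Fintype.card n : ℚ[X]) * reducedDet σ * hC

lemma sum_reducedDet_prod_swaps [Nonempty n] [Fintype {τ : Perm n // τ.IsSwap}] (m : ℕ) :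
    ∑ τ : Fin m → {τ : Perm n // τ.IsSwap}, reducedDet (List.ofFn fun i => (τ i).1).prod =
      (Fintype.card n : ℚ) ^ m • (eulerShift (((Fintype.card n : ℚ) - 1) / 2) ^ m)
        ((1 - X) ^ (Fintype.card n - 1)) := by
  induction m with
  | zero => simp [reducedDet_one]
  | succ m ih =>
    rw [← (Fin.consEquiv fun _ => {τ : Perm n // τ.IsSwap}).sum_comp, Fintype.sum_prod_type_right]
    simp only [Fin.consEquiv_apply, List.ofFn_succ, Fin.cons_zero, Fin.cons_succ, List.prod_cons]
    simp_rw [sum_reducedDet_swap_mul]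
    rw [← Finset.smul_sum, ← map_sum, ih, map_smul, smul_smul, ← pow_succ', pow_succ' (eulerShift _),
      Module.End.mul_apply]

lemma det_oneSubXPerm_of_not_sameCycle {σ : Perm n} {x y : n} (h : ¬ σ.SameCycle x y) :
    (1 - X) * (1 - X) ∣ (oneSubXPerm σ).det := by
  classical
  have hz : ∀ i j, (σ.SameCycle x i ↔ ¬ σ.SameCycle x j) → oneSubXPerm σ i j = 0 := by
    intro i j hij
    have h1 : i ≠ j := by rintro rfl; tauto
    have h2 : σ i ≠ j := by
      rintro rfl
      rw [Perm.sameCycle_apply_right] at hij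
      tauto
    simp [oneSubXPerm_apply, h1, h2]
  have hblock : ∀ (p : n → Prop) [DecidablePred p], (∀ i j, p i → ¬ p j → oneSubXPerm σ i j = 0) →
      (toSquareBlockProp (oneSubXPerm σ) p) *ᵥ (fun _ => 1) = fun _ => 1 - X := by
    intro p _ hp
    ext1 i
    refine Eq.trans ?_ (congrFun (oneSubXPerm_mulVec_one σ) i.1)
    simp only [mulVec, dotProduct, mul_one, toSquareBlockProp_def, of_apply]
    rw [← Fintype.sum_subtype_add_sum_subtype p, left_eq_add]
    exact Finset.sum_eq_zero fun j _ => hp i.1 j.1 i.2 j.2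
  rw [twoBlockTriangular_det _ (σ.SameCycle x) fun i hi j hj => hz i j (by tauto)]
  have : Nonempty {i // σ.SameCycle x i} := ⟨⟨x, Perm.SameCycle.refl σ x⟩⟩
  have : Nonempty {i // ¬ σ.SameCycle x i} := ⟨⟨y, h⟩⟩
  exact mul_dvd_mul
    (dvd_det_of_mulVec_one_eq (hblock (σ.SameCycle x) fun i j hi hj => hz i j (by tauto)))
    (dvd_det_of_mulVec_one_eq (hblock (fun i => ¬ σ.SameCycle x i) fun i j hi hj => hz i j (by tauto)))

lemma det_oneSubXPerm_of_sameCycle {σ : Perm n} [Nonempty n] (h : ∀ x y, σ.SameCycle x y) :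
    (oneSubXPerm σ).det = 1 - X ^ Fintype.card n := by
  rcases subsingleton_or_nontrivial n with hn | hn
  · rw [Subsingleton.elim σ 1, det_oneSubXPerm_one,
      le_antisymm (Fintype.card_le_one_iff_subsingleton.mpr hn) Fintype.card_pos]
    simp
  have hne : ∀ x, σ x ≠ x := by
    intro x hx
    obtain ⟨y, hy⟩ := exists_ne x
    exact hy ((h x y).eq_of_left hx).symm
  have hcycle : σ.IsCycle := by
    obtain ⟨x⟩ := ‹Nonempty n›
    exact ⟨x, hne x, fun y _ => h x y⟩
  have hone : σ⁻¹ ≠ 1 := by simpa using hcycle.ne_one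
  have hsupp : σ.support = Finset.univ := by ext x; simp [hne x]
  have hzero : ∀ π : Perm n, π ≠ 1 → π ≠ σ⁻¹ → ∏ i, oneSubXPerm σ (π i) i = 0 := by
    intro π h1 h2
    by_contra hprod
    rw [Finset.prod_eq_zero_iff] at hprod
    push Not at hprod
    have hπ : ∀ i, π i = i ∨ σ (π i) = i := by
      intro i
      by_contra! hi
      exact hprod i (Finset.mem_univ i) (by simp [oneSubXPerm_apply, hi.1, hi.2])
    have hstep : ∀ i, π i = i → π (σ i) = σ i := by
      intro i hi
      rcases hπ (σ i) with h3 | h3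
      · exact h3
      · have h4 : π (σ i) = π i := by rw [hi]; exact σ.injective h3
        exact absurd (π.injective h4) (hne i)
    obtain ⟨i, hi⟩ : ∃ i, π i = i := by
      by_contra! hall
      refine h2 (Equiv.ext fun i => ?_)
      rw [Perm.eq_inv_iff_eq]
      exact (hπ i).resolve_left (hall i)
    refine h1 (Equiv.ext fun j => ?_)
    obtain ⟨m, rfl⟩ := (h i j).exists_nat_pow_eq
    rw [Perm.one_apply]
    induction m with
    | zero => simpa using hi
    | succ m ih => rw [pow_succ', Perm.mul_apply]; exact hstep _ ih
  rw [det_apply, ← Finset.sum_subset (Finset.subset_univ {1, σ⁻¹}), Finset.sum_pair hone.symm]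
  · have e1 : ∀ i, oneSubXPerm σ i i = 1 := fun i => by simp [oneSubXPerm_apply, hne i]
    have e2 : ∀ i, oneSubXPerm σ (σ⁻¹ i) i = -X := fun i => by
      have : σ⁻¹ i ≠ i := fun hi => hne i (by rw [Perm.inv_eq_iff_eq] at hi; exact hi.symm)
      rw [oneSubXPerm_apply, if_neg this]
      simp
    simp only [Perm.one_apply, e1, e2, Perm.sign_inv, hcycle.sign, hsupp, Finset.prod_const,
      Finset.card_univ, Perm.sign_one, one_pow, one_smul, Units.smul_def, Units.val_neg,
      Units.val_pow_eq_pow_val, Units.val_one]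
    rw [neg_smul, ← sub_eq_add_neg]
    congr 1
    rcases Nat.even_or_odd (Fintype.card n) with he | he
    · simp [he.neg_one_pow, he.neg_pow]
    · simp [he.neg_one_pow, he.neg_pow]
  · intro π _ hπ
    simp only [Finset.mem_insert, Finset.mem_singleton, not_or] at hπ
    rw [hzero π hπ.1 hπ.2, smul_zero]

lemma eval_one_reducedDet [Nonempty n] (σ : Perm n) [Decidable (∀ x y, σ.SameCycle x y)] :
    (reducedDet σ).eval 1 = if ∀ x y, σ.SameCycle x y then (Fintype.card n : ℚ) else 0 := by
  split_ifs with h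
  · have : reducedDet σ = ∑ i ∈ Finset.range (Fintype.card n), X ^ i := by
      apply mul_left_cancel₀ one_sub_X_ne_zero
      rw [one_sub_X_mul_reducedDet, det_oneSubXPerm_of_sameCycle h, mul_neg_geom_sum]
    simp [this, eval_finsetSum]
  · push Not at h
    obtain ⟨x, y, hxy⟩ := h
    obtain ⟨q, hq⟩ := det_oneSubXPerm_of_not_sameCycle hxy
    have : reducedDet σ = (1 - X) * q := by
      apply mul_left_cancel₀ one_sub_X_ne_zero
      rw [one_sub_X_mul_reducedDet, hq, mul_assoc]
    simp [this]

end ReducedDeterminant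

section Counting

lemma fullCycleType_eq_singleton_iff {k : ℕ} (hk : 1 ≤ k) (σ : Perm (Fin k)) :
    fullCycleType σ = {k} ↔ ∀ x y, σ.SameCycle x y := by
  have hle : σ.support.card ≤ k := by simpa using Finset.card_le_univ σ.support
  constructor
  · intro h
    have hcard := congrArg Multiset.card h
    simp only [fullCycleType, Multiset.card_add, Multiset.card_replicate,
      Multiset.card_singleton] at hcard
    rcases Nat.eq_zero_or_pos (Multiset.card σ.cycleType) with h0 | h0
    · have h1 : σ = 1 := Perm.card_cycleType_eq_zero.mp h0
      subst h1
      have : k = 1 := by simp at hcard; omega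
      subst this
      exact fun x y => Subsingleton.elim x y ▸ Perm.SameCycle.refl _ _
    · have hc : σ.IsCycle := Perm.card_cycleType_eq_one.mp (by omega)
      have hs : σ.support = Finset.univ := by
        rw [← Finset.card_eq_iff_eq_univ, Fintype.card_fin]
        omega
      have hne : ∀ x, σ x ≠ x := fun x => by
        rw [← Perm.mem_support, hs]; exact Finset.mem_univ x
      exact fun x y => hc.sameCycle (hne x) (hne y)
  · intro h
    rcases Nat.eq_or_lt_of_le hk with h1 | h1
    · subst h1
      rw [Subsingleton.elim σ 1]
      simp [fullCycleType]
    · have : Nontrivial (Fin k) := Fin.nontrivial_iff_two_le.mpr h1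
      have hne : ∀ x, σ x ≠ x := by
        intro x hx
        obtain ⟨y, hy⟩ := exists_ne x
        exact hy ((h x y).eq_of_left hx).symm
      have hc : σ.IsCycle := ⟨⟨0, hk⟩, hne _, fun y _ => h _ y⟩
      have hs : σ.support = Finset.univ := by ext x; simp [hne x]
      simp [fullCycleType, hc.cycleType, hs]

lemma oneHoleCount_mul_eq {g k : ℕ} (hk : 1 ≤ k) :
    (oneHoleCount g k : ℚ) * k = (k : ℚ) ^ (k + 2 * g - 1) *
      alternatingPowerSum (k + 2 * g - 1) (k - 1) (((k : ℚ) - 1) / 2) := by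
  classical
  have : Nonempty (Fin k) := ⟨⟨0, hk⟩⟩
  have h := congrArg (eval 1) (sum_reducedDet_prod_swaps (n := Fin k) (k + 2 * g - 1))
  rw [eval_finsetSum] at h
  simp_rw [eval_one_reducedDet] at h
  rw [← Finset.sum_filter, Finset.sum_const, nsmul_eq_mul, eval_smul, smul_eq_mul,
    Fintype.card_fin] at h
  rw [alternatingPowerSum, ← h]
  congr 2
  rw [oneHoleCount, ← Fintype.card_subtype, ← Nat.card_eq_fintype_card]
  simp_rw [← fullCycleType_eq_singleton_iff hk]
  exact Nat.card_congr
    { toFun := fun τ => ⟨fun i => ⟨τ.1 i, τ.2.1 i⟩, τ.2.2⟩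
      invFun := fun τ => ⟨fun i => (τ.1 i).1, fun i => (τ.1 i).2, τ.2⟩
      left_inv := fun _ => rfl
      right_inv := fun _ => rfl }

lemma oneHoleCount_two {k : ℕ} (hk : 1 ≤ k) :
    (oneHoleCount 2 k : ℚ) =
      ((k : ℚ) - 1) * (5 * (k : ℚ) - 7) * ((k + 3).factorial : ℚ) * (k : ℚ) ^ (k + 2) / 5760 := by
  have h := oneHoleCount_mul_eq (g := 2) hk
  obtain ⟨d, rfl⟩ := Nat.exists_eq_add_of_le' hk
  have hd : ((d + 1 : ℕ) : ℚ) ≠ 0 := by positivity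
  apply mul_right_cancel₀ hd
  rw [h, show d + 1 + 2 * 2 - 1 = d + 4 from rfl, show d + 1 - 1 = d from rfl,
    alternatingPowerSum_add_four, show d + 1 + 3 = d + 4 from rfl, show d + 1 + 2 = d + 3 from rfl,
    pow_succ _ (d + 3)]
  push_cast
  ring

end Counting

end HookCharacters

/-- Genus-two, one-pole case of Theorem 1.1: the number of `(k+3)`-tuples of
transpositions in `S_k` whose product is a `k`-cycle equals
`(k-1)(5k-7)(k+3)! k^{k+2} / 5760`; equivalently
`h_{2;k} = (k-1)(5k-7)(k+3)! k^{k+2} / (5760 k!)`. -/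
theorem one_hole_genus_two (k : ℕ) (hk : 1 ≤ k) :
    (oneHoleCount 2 k : ℚ)
      = ((k : ℚ) - 1) * (5 * (k : ℚ) - 7) * ((k + 3).factorial : ℚ)
          * (k : ℚ) ^ (k + 2) / 5760 ∧
    oneHoleHurwitzNumber 2 k
      = ((k : ℚ) - 1) * (5 * (k : ℚ) - 7) * ((k + 3).factorial : ℚ)
          * (k : ℚ) ^ (k + 2) / (5760 * (k.factorial : ℚ)) := by
  refine ⟨oneHoleCount_two hk, ?_⟩
  rw [oneHoleHurwitzNumber, oneHoleCount_two hk, div_div]
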